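/- Fix 1 ≤ p ≤ ∞, 0 < δ < 1, integers 1 ≤ m < n with δ = (m−1)/n, and let t*_p = t*_p(δ;n) be the unique solution of δ = D_p(t) − (t/2)D_p'(t), where D_p(t;n) = (1/n)[E_{h∼N(0,I_n)} dist(h, {x : ‖x‖_{p*} ≤ t})]². There is a universal constant C, independent of δ, p, and n, such that for all n ≥ 1, D_p(t*_p; n) ≥ (δ/C)². -/

import Mathlib

open MeasureTheory ProbabilityTheory Filter
open scoped ENNReal NNReal

/-- The standard Gaussian measure `N(0, I_n)` on `ℝ^n`. -/
noncomputable def stdGaussian (n : ℕ) : Measure (Fin n → ℝ) :=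
  Measure.pi fun _ => gaussianReal 0 1

/-- The Euclidean (`ℓ²`) norm on `ℝ^n`. -/
noncomputable def l2norm {n : ℕ} (x : Fin n → ℝ) : ℝ := Real.sqrt (∑ i, x i ^ 2)

/-- The `ℓ^q` norm on `ℝ^n` for an extended exponent `q ∈ [1, ∞]`. -/
noncomputable def lqNorm {n : ℕ} (q : ℝ≥0∞) (x : Fin n → ℝ) : ℝ :=
  if q = ⊤ then ⨆ i, |x i| else (∑ i, |x i| ^ q.toReal) ^ (1 / q.toReal)

/-- Euclidean distance from `h ∈ ℝ^n` to a set `C ⊆ ℝ^n`. -/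
noncomputable def distL2 {n : ℕ} (C : Set (Fin n → ℝ)) (h : Fin n → ℝ) : ℝ :=
  sInf ((fun w => l2norm (h - w)) '' C)

/-- `D_p(t; n) = (1/n) (E_{h ∼ N(0,I_n)} dist(h, {x : ‖x‖_{p*} ≤ t}))²`, expressed in terms
of the Hölder conjugate exponent `q = p*`. -/
noncomputable def Dp (q : ℝ≥0∞) (n : ℕ) (t : ℝ) : ℝ :=
  (1 / n) * (∫ h, distL2 {x | lqNorm q x ≤ t} h ∂stdGaussian n) ^ 2


lemma l2norm_eq_norm {n : ℕ} (x : Fin n → ℝ) : l2norm x = ‖WithLp.toLp 2 x‖ := by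
  simp [l2norm, EuclideanSpace.norm_eq]

lemma lqNorm_smul_le {n : ℕ} {q : ℝ≥0∞} (hq : q ≠ 0) {c : ℝ} (hc : 0 ≤ c) (x : Fin n → ℝ) :
    lqNorm q (c • x) ≤ c * lqNorm q x := by
  unfold lqNorm
  split_ifs with h
  · rw [Real.mul_iSup_of_nonneg hc]
    simp [abs_mul, abs_of_nonneg hc]
  · have hr : 0 < q.toReal := ENNReal.toReal_pos hq h
    have hs : 0 ≤ ∑ i, |x i| ^ q.toReal :=
      Finset.sum_nonneg fun i _ => Real.rpow_nonneg (abs_nonneg _) _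
    have hsum : ∑ i, |(c • x) i| ^ q.toReal = c ^ q.toReal * ∑ i, |x i| ^ q.toReal := by
      rw [Finset.mul_sum]
      refine Finset.sum_congr rfl fun i _ => ?_
      rw [Pi.smul_apply, smul_eq_mul, abs_mul, abs_of_nonneg hc,
        Real.mul_rpow hc (abs_nonneg _)]
    rw [hsum, Real.mul_rpow (Real.rpow_nonneg hc _) hs, ← Real.rpow_mul hc,
      mul_one_div_cancel hr.ne', Real.rpow_one]

lemma lqNorm_zero_le {n : ℕ} {q : ℝ≥0∞} (hq : q ≠ 0) : lqNorm q (0 : Fin n → ℝ) ≤ 0 := by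
  simpa using lqNorm_smul_le hq le_rfl (0 : Fin n → ℝ)

lemma distL2_nonneg {n : ℕ} (C : Set (Fin n → ℝ)) (h : Fin n → ℝ) : 0 ≤ distL2 C h :=
  Real.sInf_nonneg (by rintro _ ⟨w, -, rfl⟩; exact Real.sqrt_nonneg _)

lemma distL2_le {n : ℕ} {C : Set (Fin n → ℝ)} {w : Fin n → ℝ} (hw : w ∈ C) (h : Fin n → ℝ) :
    distL2 C h ≤ l2norm (h - w) :=
  csInf_le ⟨0, by rintro _ ⟨w, -, rfl⟩; exact Real.sqrt_nonneg _⟩ ⟨w, hw, rfl⟩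

lemma distL2_eq_infDist {n : ℕ} (C : Set (Fin n → ℝ)) (h : Fin n → ℝ) :
    distL2 C h = Metric.infDist (WithLp.toLp 2 h) (WithLp.toLp 2 '' C) := by
  rw [Metric.infDist_eq_iInf, distL2, sInf_image']
  refine (Equiv.Set.image _ C (WithLp.toLp_injective 2)).iInf_congr fun w => ?_
  simp [l2norm_eq_norm, dist_eq_norm]

lemma continuous_distL2 {n : ℕ} (C : Set (Fin n → ℝ)) : Continuous (distL2 C) := by
  rw [funext (distL2_eq_infDist C)]
  exact (Metric.continuous_infDist_pt _).comp (PiLp.continuous_toLp 2 _)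

lemma continuous_l2norm {n : ℕ} : Continuous (l2norm : (Fin n → ℝ) → ℝ) := by
  unfold l2norm
  fun_prop

lemma distL2_lqBall_le_l2norm {n : ℕ} {q : ℝ≥0∞} (hq : q ≠ 0) {t : ℝ} (ht : 0 ≤ t)
    (h : Fin n → ℝ) : distL2 {x | lqNorm q x ≤ t} h ≤ l2norm h := by
  simpa using distL2_le (C := {x | lqNorm q x ≤ t}) ((lqNorm_zero_le hq).trans ht) h

/-- Convexity, along a segment ending at radius `0`, of the distance to a dilated ball. -/
lemma distL2_lqBall_shrink_le {n : ℕ} {q : ℝ≥0∞} (hq : q ≠ 0) {t ε : ℝ} (ht : 0 ≤ t)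
    (hε : 0 ≤ ε) (hε1 : ε ≤ 1) (h : Fin n → ℝ) :
    distL2 {x | lqNorm q x ≤ (1 - ε) * t} h ≤
      (1 - ε) * distL2 {x | lqNorm q x ≤ t} h + ε * l2norm h := by
  have h1 : 0 ≤ 1 - ε := by linarith
  have hne : Nonempty {x : Fin n → ℝ | lqNorm q x ≤ t} := ⟨⟨0, (lqNorm_zero_le hq).trans ht⟩⟩
  rw [distL2.eq_1 {x | lqNorm q x ≤ t}, sInf_image', Real.mul_iInf_of_nonneg h1,
    ← sub_le_iff_le_add]
  refine le_ciInf fun w => sub_le_iff_le_add.2 ?_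
  have hw : (1 - ε) • (w : Fin n → ℝ) ∈ {x : Fin n → ℝ | lqNorm q x ≤ (1 - ε) * t} :=
    (lqNorm_smul_le hq h1 _).trans (mul_le_mul_of_nonneg_left w.2 h1)
  refine (distL2_le hw h).trans ?_
  have hdecomp : h - (1 - ε) • (w : Fin n → ℝ) = (1 - ε) • (h - w) + ε • h := by module
  rw [hdecomp]
  simp only [l2norm_eq_norm]
  refine (norm_add_le _ _).trans_eq ?_
  rw [WithLp.toLp_smul, WithLp.toLp_smul, norm_smul, norm_smul, Real.norm_of_nonneg h1,
    Real.norm_of_nonneg hε]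

instance isProbabilityMeasure_stdGaussian_pi (n : ℕ) :
    IsProbabilityMeasure (_root_.stdGaussian n) := by
  unfold _root_.stdGaussian
  infer_instance

lemma memLp_eval_stdGaussian {n : ℕ} (i : Fin n) :
    MemLp (fun h : Fin n → ℝ => h i) 2 (_root_.stdGaussian n) :=
  (memLp_id_gaussianReal 2).comp_measurePreserving
    (measurePreserving_eval (fun _ : Fin n => gaussianReal 0 1) i)

lemma integral_eval_sq_stdGaussian {n : ℕ} (i : Fin n) :
    ∫ h, h i ^ 2 ∂_root_.stdGaussian n = 1 := by
  have hv : ∫ x, x ^ 2 ∂gaussianReal 0 1 = 1 := by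
    have := variance_eq_sub (memLp_id_gaussianReal (μ := 0) (v := 1) 2)
    simpa using this.symm
  rw [← hv]
  exact integral_comp_eval (μ := fun _ : Fin n => gaussianReal 0 1) (i := i)
    (f := fun x : ℝ => x ^ 2) (by fun_prop)

lemma integrable_sum_sq_stdGaussian (n : ℕ) :
    Integrable (fun h : Fin n → ℝ => ∑ i, h i ^ 2) (_root_.stdGaussian n) :=
  integrable_finsetSum _ fun i _ => (memLp_eval_stdGaussian i).integrable_sq

lemma l2norm_le_add {n : ℕ} (hn : 0 < n) (h : Fin n → ℝ) :
    l2norm h ≤ (2 * √n)⁻¹ * ∑ i, h i ^ 2 + √n / 2 := by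
  have hs : 0 < √(n : ℝ) := Real.sqrt_pos.2 (Nat.cast_pos.2 hn)
  have hsum : ∑ i, h i ^ 2 = l2norm h ^ 2 :=
    (Real.sq_sqrt (Finset.sum_nonneg fun i _ => sq_nonneg _)).symm
  have key : (2 * √n)⁻¹ * l2norm h ^ 2 + √n / 2 - l2norm h
      = (2 * √n)⁻¹ * (l2norm h - √n) ^ 2 := by
    field_simp
    ring
  rw [hsum, ← sub_nonneg, key]
  positivity

lemma integrable_l2norm_stdGaussian {n : ℕ} (hn : 0 < n) :
    Integrable (l2norm : (Fin n → ℝ) → ℝ) (_root_.stdGaussian n) := by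
  refine (((integrable_sum_sq_stdGaussian n).const_mul (2 * √n)⁻¹).add
    (integrable_const (√n / 2))).mono' continuous_l2norm.aestronglyMeasurable
    (.of_forall fun h => ?_)
  exact (Real.norm_of_nonneg (Real.sqrt_nonneg _)).trans_le (l2norm_le_add hn h)

lemma integral_l2norm_stdGaussian_le {n : ℕ} (hn : 0 < n) :
    ∫ h, l2norm h ∂_root_.stdGaussian n ≤ √n := by
  have hs : 0 < √(n : ℝ) := Real.sqrt_pos.2 (Nat.cast_pos.2 hn)
  have hI := (integrable_sum_sq_stdGaussian n).const_mul (2 * √n)⁻¹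
  refine (integral_mono (integrable_l2norm_stdGaussian hn)
    (hI.add (integrable_const (√n / 2))) fun h => l2norm_le_add hn h).trans_eq ?_
  rw [integral_add' hI (integrable_const _), integral_const_mul,
    integral_finsetSum _ fun i _ => (memLp_eval_stdGaussian i).integrable_sq]
  simp only [integral_eval_sq_stdGaussian, integral_const, Finset.sum_const, Finset.card_univ,
    Fintype.card_fin, nsmul_eq_mul, mul_one, probReal_univ, smul_eq_mul, one_mul]
  have hsq : √(n : ℝ) ^ 2 = n := Real.sq_sqrt (Nat.cast_nonneg n)
  field_simp
  linarith

lemma integrable_distL2_lqBall {n : ℕ} (hn : 0 < n) {q : ℝ≥0∞} (hq : q ≠ 0) {t : ℝ}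
    (ht : 0 ≤ t) : Integrable (distL2 {x | lqNorm q x ≤ t}) (_root_.stdGaussian n) := by
  refine (integrable_l2norm_stdGaussian hn).mono' (continuous_distL2 _).aestronglyMeasurable
    (.of_forall fun h => ?_)
  rw [Real.norm_of_nonneg (distL2_nonneg _ _)]
  exact distL2_lqBall_le_l2norm hq ht h

lemma integral_distL2_lqBall_shrink_le {n : ℕ} (hn : 0 < n) {q : ℝ≥0∞} (hq : q ≠ 0) {t ε : ℝ}
    (ht : 0 ≤ t) (hε : 0 ≤ ε) (hε1 : ε ≤ 1) :
    ∫ h, distL2 {x | lqNorm q x ≤ (1 - ε) * t} h ∂_root_.stdGaussian n ≤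
      (1 - ε) * ∫ h, distL2 {x | lqNorm q x ≤ t} h ∂_root_.stdGaussian n + ε * √n := by
  have h1 := (integrable_distL2_lqBall hn hq ht).const_mul (1 - ε)
  have h2 := (integrable_l2norm_stdGaussian hn).const_mul ε
  calc _ ≤ ∫ h, ((1 - ε) * distL2 {x | lqNorm q x ≤ t} h + ε * l2norm h)
        ∂_root_.stdGaussian n :=
        integral_mono (integrable_distL2_lqBall hn hq (mul_nonneg (by linarith) ht))
          (h1.add h2) fun h => distL2_lqBall_shrink_le hq ht hε hε1 h
    _ = (1 - ε) * ∫ h, distL2 {x | lqNorm q x ≤ t} h ∂_root_.stdGaussian n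
        + ε * ∫ h, l2norm h ∂_root_.stdGaussian n := by
        rw [integral_add h1 h2, integral_const_mul, integral_const_mul]
    _ ≤ _ := by gcongr; exact integral_l2norm_stdGaussian_le hn

/-- One-sided comparison of derivatives at a point where two functions touch. -/
lemma HasDerivAt.le_of_le_right {f g : ℝ → ℝ} {f' g' a b : ℝ} (hf : HasDerivAt f f' a)
    (hg : HasDerivAt g g' a) (hab : a < b) (heq : f a = g a)
    (hle : ∀ x ∈ Set.Ioo a b, f x ≤ g x) : f' ≤ g' := by
  have hf' := hf.hasDerivWithinAt (s := Set.Ioi a)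
  have hg' := hg.hasDerivWithinAt (s := Set.Ioi a)
  rw [hasDerivWithinAt_iff_tendsto_slope' Set.self_notMem_Ioi] at hf' hg'
  refine le_of_tendsto_of_tendsto hf' hg' ?_
  filter_upwards [Ioo_mem_nhdsGT hab] with x hx
  have hxa : 0 < x - a := sub_pos.2 hx.1
  simp only [slope_def_field, heq]
  have := hle x hx
  gcongr

lemma Dp_sub_deriv_le {n : ℕ} (hn : 0 < n) {q : ℝ≥0∞} (hq : q ≠ 0) {t : ℝ} (ht : 0 ≤ t)
    (hd : DifferentiableAt ℝ (Dp q n) t) :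
    Dp q n t - t / 2 * deriv (Dp q n) t ≤
      1 / n * ((∫ h, distL2 {x | lqNorm q x ≤ t} h ∂_root_.stdGaussian n) * √n) := by
  set f := ∫ h, distL2 {x | lqNorm q x ≤ t} h ∂_root_.stdGaussian n with hf
  have hline : HasDerivAt (fun ε : ℝ => (1 - ε) * t) (-t) 0 := by
    simpa using ((hasDerivAt_id (0 : ℝ)).const_sub 1).mul_const t
  have hD : HasDerivAt (fun ε : ℝ => Dp q n ((1 - ε) * t)) (deriv (Dp q n) t * -t) 0 := by
    refine HasDerivAt.comp (h₂ := Dp q n) (0 : ℝ) ?_ hline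
    rw [sub_zero, one_mul]
    exact hd.hasDerivAt
  have haff : HasDerivAt (fun ε : ℝ => (1 - ε) * f + ε * √n) (-f + √n) 0 := by
    simpa using (((hasDerivAt_id' (0 : ℝ)).const_sub 1).mul_const f).fun_add
      ((hasDerivAt_id' (0 : ℝ)).mul_const √n)
  have hG : HasDerivAt (fun ε : ℝ => 1 / (n : ℝ) * ((1 - ε) * f + ε * √n) ^ 2)
      (1 / n * (2 * f * (-f + √n))) 0 := by
    simpa using (haff.pow 2).const_mul (1 / (n : ℝ))
  have hle := hD.le_of_le_right hG one_pos (by simp [Dp, hf]) fun ε hε => by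
    have hnonneg : 0 ≤ ∫ h, distL2 {x | lqNorm q x ≤ (1 - ε) * t} h ∂_root_.stdGaussian n :=
      integral_nonneg fun h => distL2_nonneg _ h
    unfold Dp
    gcongr
    exact integral_distL2_lqBall_shrink_le hn hq ht hε.1.le hε.2.le
  have hDt : Dp q n t = 1 / n * f ^ 2 := rfl
  rw [hDt]
  linarith

/-- There is a universal constant `C > 0`, independent of `δ`, `p`, and
`n`, such that `D_p(t*_p; n) ≥ (δ/C)²`, where `t*_p = t*_p(δ; n)` is the unique positive
solution of `δ = D_p(t) − (t/2) D_p'(t)` and `q = p*` is the Hölder conjugate of `p`. -/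
theorem Dp_at_tstar_lower_bound :
    ∃ C : ℝ, 0 < C ∧
      ∀ (m n : ℕ), 1 ≤ m → m < n →
        ∀ p q : ℝ≥0∞, 1 ≤ p → 1 / p + 1 / q = 1 →
        ∀ δ : ℝ, 0 < δ → δ < 1 → δ = ((m : ℝ) - 1) / n →
        ∀ tstar : ℝ, 0 < tstar →
          δ = Dp q n tstar - (tstar / 2) * deriv (Dp q n) tstar →
          (δ / C) ^ 2 ≤ Dp q n tstar := by
  refine ⟨1, one_pos, fun m n _ hmn p q _ hpq δ hδ hδ1 _ t ht heq => ?_⟩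
  have hn : 0 < n := by omega
  have hq : q ≠ 0 := by
    rintro rfl
    simp at hpq
  rw [div_one]
  by_cases hd : DifferentiableAt ℝ (Dp q n) t
  · have hle := heq.trans_le (Dp_sub_deriv_le hn hq ht.le hd)
    calc δ ^ 2 ≤ _ := pow_le_pow_left₀ hδ.le hle 2
      _ = Dp q n t := by
        have hn' : (n : ℝ) ≠ 0 := Nat.cast_ne_zero.2 hn.ne'
        rw [mul_pow, mul_pow, Real.sq_sqrt (Nat.cast_nonneg n), Dp]
        field_simp
  · rw [deriv_zero_of_not_differentiableAt hd, mul_zero, sub_zero] at heq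
    rw [← heq]
    nlinarith
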